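/- Let w : ℝ → ℝ be 1-periodic, continuously differentiable, and satisfy w(x) > 0 for all x, and define ψ_l(x) = e^{2πilx}/w(x) for l ∈ ℤ. Let 0 ≤ θ < 1/2 and let λ : ℤ → ℝ be a jittered sampling sequence, i.e., |λ_j − j| ≤ θ for all j ∈ ℤ, and set φ_j(x) = e^{2πiλ_j x}. Then there exists a constant c₁ > 0 such that for all j, l ∈ ℤ, |⟨φ_j, ψ_l⟩| = |∫₀¹ w(x)^{-1}·e^{2πi(λ_j − l)x} dx| ≤ c₁·(1 + |j−l|)^{-1}. -/

import Mathlib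

open MeasureTheory Complex Set

/-- The Fourier integral over `[0, 1]` of a continuously differentiable function decays like
`(1 + |μ|)⁻¹` in the frequency `μ`. -/
theorem exists_norm_fourier_integral_unit_interval_le {g g' : ℝ → ℂ}
    (hg : ∀ x, HasDerivAt g (g' x) x) (hg' : Continuous g') :
    ∃ C : ℝ, 0 < C ∧ ∀ μ : ℝ,
      (1 + |μ|) * ‖∫ x in (0 : ℝ)..1, g x * exp (2 * (Real.pi : ℂ) * I * (μ : ℂ) * (x : ℂ))‖ ≤
        C := by
  have hgc : Continuous g := continuous_iff_continuousAt.2 fun x => (hg x).continuousAt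
  obtain ⟨M, hM⟩ := isCompact_Icc.exists_bound_of_continuousOn (s := Icc (0 : ℝ) 1)
    hgc.continuousOn
  obtain ⟨M', hM'⟩ := isCompact_Icc.exists_bound_of_continuousOn (s := Icc (0 : ℝ) 1)
    hg'.continuousOn
  have h0 := hM 0 (by simp)
  have h1 := hM 1 (by simp)
  have hM0 : 0 ≤ M := (norm_nonneg _).trans h0
  have hM'0 : 0 ≤ M' := (norm_nonneg _).trans (hM' 0 (by simp))
  refine ⟨3 * M + M' + 1, by positivity, fun μ => ?_⟩
  set a : ℂ := 2 * (Real.pi : ℂ) * I * (μ : ℂ) with ha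
  have hnorm (x : ℝ) : ‖exp (a * x)‖ = 1 := by
    rw [show a * x = ((2 * Real.pi * μ * x : ℝ) : ℂ) * I by rw [ha]; push_cast; ring,
      norm_exp_ofReal_mul_I]
  have hexp (x : ℝ) : HasDerivAt (fun y : ℝ => exp (a * y)) (exp (a * x) * a) x := by
    simpa using ((hasDerivAt_id x).ofReal_comp.const_mul a).cexp
  have hexpc : Continuous fun x : ℝ => exp (a * x) := by fun_prop
  have hbound {f : ℝ → ℂ} {B : ℝ} (hf : ∀ x ∈ Icc (0 : ℝ) 1, ‖f x‖ ≤ B) :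
      ‖∫ x in (0 : ℝ)..1, f x * exp (a * x)‖ ≤ B := by
    have := intervalIntegral.norm_integral_le_of_norm_le_const (a := (0 : ℝ)) (b := 1)
      (f := fun x : ℝ => f x * exp (a * x)) (C := B) fun x hx => by
        rw [uIoc_of_le zero_le_one] at hx
        simpa [hnorm] using hf x (Ioc_subset_Icc_self hx)
    simpa using this
  have hparts : a * ∫ x in (0 : ℝ)..1, g x * exp (a * x) =
      g 1 * exp (a * (1 : ℝ)) - g 0 * exp (a * (0 : ℝ)) -
        ∫ x in (0 : ℝ)..1, g' x * exp (a * x) := by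
    have hi : IntervalIntegrable (fun x : ℝ => g' x * exp (a * x)) volume 0 1 :=
      (hg'.mul hexpc).intervalIntegrable _ _
    have hi' : IntervalIntegrable (fun x : ℝ => g x * (exp (a * x) * a)) volume 0 1 :=
      (hgc.mul (hexpc.mul continuous_const)).intervalIntegrable _ _
    have h := intervalIntegral.integral_eq_sub_of_hasDerivAt (a := (0 : ℝ)) (b := 1)
      (fun x _ => (hg x).mul (hexp x)) (hi.add hi')
    rw [intervalIntegral.integral_add hi hi'] at h
    simp only [Pi.mul_apply] at h
    rw [← h, ← intervalIntegral.integral_const_mul, add_sub_cancel_left]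
    exact intervalIntegral.integral_congr fun x _ => by ring
  have hna : ‖a‖ = 2 * Real.pi * |μ| := by
    simp [ha, abs_of_pos Real.pi_pos]
  have hμ : |μ| ≤ ‖a‖ := by
    rw [hna]
    nlinarith [abs_nonneg μ, Real.pi_gt_three]
  have hI := hbound hM
  have haI : ‖a‖ * ‖∫ x in (0 : ℝ)..1, g x * exp (a * x)‖ ≤ M + M + M' := by
    rw [← norm_mul, hparts]
    refine (norm_sub_le _ _).trans (add_le_add ((norm_sub_le _ _).trans ?_) (hbound hM'))
    simpa only [norm_mul, hnorm, mul_one] using add_le_add h1 h0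
  have := mul_le_mul_of_nonneg_right hμ
    (norm_nonneg (∫ x in (0 : ℝ)..1, g x * exp (a * x)))
  linarith

/-- If `w : ℝ → ℝ` is 1-periodic, continuously differentiable and strictly positive,
`λ : ℤ → ℝ` is a jittered sampling sequence with maximal jitter `θ < 1/2`, then the
cross-Gram entries of `φ_j = e^{2πiλ_j x}` against `ψ_l = e^{2πilx}/w`,
`⟨φ_j, ψ_l⟩ = ∫₀¹ w(x)⁻¹ e^{2πi(λ_j−l)x} dx`, decay like `(1 + |j−l|)⁻¹`. -/
theorem phi_psi_cross_gram_decay (w : ℝ → ℝ)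
    (hw_per : Function.Periodic w 1)
    (hw_smooth : ContDiff ℝ 1 w)
    (hw_pos : ∀ x : ℝ, 0 < w x)
    (θ : ℝ) (hθ0 : 0 ≤ θ) (hθ : θ < 1 / 2)
    (lam : ℤ → ℝ) (hlam : ∀ j : ℤ, |lam j - (j : ℝ)| ≤ θ) :
    ∃ c₁ : ℝ, 0 < c₁ ∧ ∀ j l : ℤ,
      ‖∫ x in Set.Icc (0 : ℝ) 1,
          ((w x : ℂ))⁻¹ *
            Complex.exp (2 * (Real.pi : ℂ) * Complex.I * ((lam j : ℂ) - (l : ℂ)) * (x : ℂ))‖ ≤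
        c₁ * ((1 + |(j : ℝ) - (l : ℝ)|))⁻¹ := by
  have hw_deriv (x : ℝ) : HasDerivAt w (deriv w x) x :=
    (hw_smooth.differentiable one_ne_zero x).hasDerivAt
  have hw_ne (x : ℝ) : (w x : ℂ) ≠ 0 := ofReal_ne_zero.2 (hw_pos x).ne'
  have hw'_cont : Continuous (deriv w) := hw_smooth.continuous_deriv le_rfl
  have hw_cont : Continuous w := hw_smooth.continuous
  have hinv (x : ℝ) : HasDerivAt (fun y => (w y : ℂ)⁻¹)
      (-((deriv w x : ℝ) : ℂ) / (w x : ℂ) ^ 2) x :=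
    (hw_deriv x).ofReal_comp.fun_inv (hw_ne x)
  obtain ⟨C, hC, hdecay⟩ := exists_norm_fourier_integral_unit_interval_le
    hinv (Continuous.div (by fun_prop) (by fun_prop) fun x => pow_ne_zero 2 (hw_ne x))
  refine ⟨2 * C, by positivity, fun j l => ?_⟩
  have h := hdecay (lam j - l)
  rw [intervalIntegral.integral_of_le zero_le_one, ← integral_Icc_eq_integral_Ioc] at h
  push_cast at h
  rw [← div_eq_mul_inv, le_div_iff₀ (by positivity)]
  have hjl : 1 + |(j : ℝ) - l| ≤ 2 * (1 + |lam j - l|) := by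
    have h₁ := abs_sub_le (j : ℝ) (lam j) l
    have h₂ := hlam j
    rw [abs_sub_comm] at h₂
    linarith [abs_nonneg (lam j - l)]
  refine (mul_le_mul_of_nonneg_left hjl (norm_nonneg _)).trans ?_
  linarith
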